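/- Let 𝔤 be a finite-dimensional complex Lie algebra and z ∈ 𝔤, and write 𝔤_k = {x ∈ 𝔤 : ⁅z, x⁆ = k • x}. Assume: (i) 𝔤 is the internal direct sum of 𝔤₋₂, 𝔤₋₁, 𝔤₀, 𝔤₁ and 𝔤₂; (ii) dim 𝔤₂ = dim 𝔤₋₂ = 1, 𝔤₁ ≠ 0 and 𝔤₋₁ ≠ 0; (iii) the only subspaces of 𝔤₁ invariant under ad X for every X ∈ 𝔤₀ are 0 and 𝔤₁, and likewise for 𝔤₋₁; (iv) 𝔤₀ equals the linear span of the brackets ⁅x, y⁆ with x ∈ 𝔤₁ and y ∈ 𝔤₋₁; (v) the linear span of the brackets ⁅y, e⁆ with y ∈ 𝔤₋₁, e ∈ 𝔤₂ equals 𝔤₁, and the linear span of the brackets ⁅x, f⁆ with x ∈ 𝔤₁, f ∈ 𝔤₋₂ equals 𝔤₋₁; (vi) if X ∈ 𝔤₀ satisfies ⁅X, x⁆ = 0 for all x ∈ 𝔤₁ and ⁅X, y⁆ = 0 for all y ∈ 𝔤₋₁, then X = 0. Then 𝔤 is a simple Lie algebra. -/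

import Mathlib

/-- The eigenspace `𝔤_k = {x ∈ 𝔤 : ⁅z, x⁆ = k • x}` of `ad z`. -/
def adEigenspace (𝔤 : Type*) [LieRing 𝔤] [LieAlgebra ℂ 𝔤] (z : 𝔤) (k : ℤ) :
    Submodule ℂ 𝔤 :=
  Module.End.eigenspace (LieAlgebra.ad ℂ 𝔤 z) (k : ℂ)

theorem mem_adEigenspace_iff {𝔤 : Type*} [LieRing 𝔤] [LieAlgebra ℂ 𝔤] {z x : 𝔤} {k : ℤ} :
    x ∈ adEigenspace 𝔤 z k ↔ ⁅z, x⁆ = (k : ℂ) • x := by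
  rw [adEigenspace, Module.End.mem_eigenspace_iff, LieAlgebra.ad_apply]

theorem lie_mem_adEigenspace {𝔤 : Type*} [LieRing 𝔤] [LieAlgebra ℂ 𝔤] {z x y : 𝔤} {j k l : ℤ}
    (h : j + k = l) (hx : x ∈ adEigenspace 𝔤 z j) (hy : y ∈ adEigenspace 𝔤 z k) :
    ⁅x, y⁆ ∈ adEigenspace 𝔤 z l := by
  rw [mem_adEigenspace_iff] at *
  rw [leibniz_lie, hx, hy, smul_lie, lie_smul, ← add_smul, ← h, Int.cast_add]

/-- A nonzero ideal of a finite-dimensional complex Lie algebra contains an eigenvector of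
`ad z`. -/
theorem LieIdeal.exists_eigenvector_ad {𝔤 : Type*} [LieRing 𝔤] [LieAlgebra ℂ 𝔤]
    [FiniteDimensional ℂ 𝔤] (z : 𝔤) {I : LieIdeal ℂ 𝔤} (hI : I ≠ ⊥) :
    ∃ μ : ℂ, ∃ x ∈ I, x ≠ 0 ∧ ⁅z, x⁆ = μ • x := by
  have : Nontrivial I := (LieSubmodule.nontrivial_iff_ne_bot ℂ 𝔤 𝔤).mpr hI
  obtain ⟨μ, hμ⟩ := Module.End.exists_eigenvalue (LieModule.toEnd ℂ 𝔤 I z)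
  obtain ⟨x, hx⟩ := hμ.exists_hasEigenvector
  refine ⟨μ, x, x.2, fun h => hx.2 (Subtype.ext h), ?_⟩
  simpa using congrArg Subtype.val hx.apply_eq_smul

/-- If the integral eigenspaces of `ad z` span `𝔤`, then every eigenvalue of `ad z` occurs among
the spanning family. -/
theorem exists_eq_of_iSup_adEigenspace_eq_top {𝔤 ι : Type*} [LieRing 𝔤] [LieAlgebra ℂ 𝔤] {z : 𝔤}
    {k : ι → ℤ} (h : ⨆ i, adEigenspace 𝔤 z (k i) = ⊤) {μ : ℂ} {x : 𝔤} (hx : x ≠ 0)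
    (hμ : ⁅z, x⁆ = μ • x) : ∃ i, μ = k i := by
  by_contra! hne
  have hdisj := Module.End.eigenspaces_iSupIndep (LieAlgebra.ad ℂ 𝔤 z) μ
  have htop : ⨆ ν, ⨆ (_ : ν ≠ μ), Module.End.eigenspace (LieAlgebra.ad ℂ 𝔤 z) ν = ⊤ := by
    rw [eq_top_iff, ← h]
    exact iSup_le fun i => le_iSup₂_of_le (k i : ℂ) (hne i).symm le_rfl
  rw [htop, disjoint_top] at hdisj
  have : x ∈ Module.End.eigenspace (LieAlgebra.ad ℂ 𝔤 z) μ := by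
    rwa [Module.End.mem_eigenspace_iff, LieAlgebra.ad_apply]
  rw [hdisj] at this
  exact hx ((Submodule.mem_bot ℂ).mp this)

/-- A five-step graded Lie algebra
`𝔤 = 𝔤₋₂ ⊕ 𝔤₋₁ ⊕ 𝔤₀ ⊕ 𝔤₁ ⊕ 𝔤₂` with `dim 𝔤±₂ = 1`, `𝔤₀` acting irreducibly and
faithfully on the nonzero pieces `𝔤±₁`, `𝔤₀ = ⁅𝔤₁, 𝔤₋₁⁆`, `⁅𝔤₋₁, 𝔤₂⁆ = 𝔤₁` and
`⁅𝔤₁, 𝔤₋₂⁆ = 𝔤₋₁`, is simple. -/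
theorem simple_of_five_step_grading {𝔤 : Type*} [LieRing 𝔤] [LieAlgebra ℂ 𝔤]
    [FiniteDimensional ℂ 𝔤] (z : 𝔤)
    (h1 : DirectSum.IsInternal
      ![adEigenspace 𝔤 z (-2), adEigenspace 𝔤 z (-1), adEigenspace 𝔤 z 0,
        adEigenspace 𝔤 z 1, adEigenspace 𝔤 z 2])
    (h2 : Module.finrank ℂ (adEigenspace 𝔤 z 2) = 1)
    (h2' : Module.finrank ℂ (adEigenspace 𝔤 z (-2)) = 1)
    (h2'' : adEigenspace 𝔤 z 1 ≠ ⊥)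
    (h2''' : adEigenspace 𝔤 z (-1) ≠ ⊥)
    (h3 : ∀ W : Submodule ℂ 𝔤, W ≤ adEigenspace 𝔤 z 1 →
      (∀ X ∈ adEigenspace 𝔤 z 0, ∀ w ∈ W, ⁅X, w⁆ ∈ W) →
      W = ⊥ ∨ W = adEigenspace 𝔤 z 1)
    (h3' : ∀ W : Submodule ℂ 𝔤, W ≤ adEigenspace 𝔤 z (-1) →
      (∀ X ∈ adEigenspace 𝔤 z 0, ∀ w ∈ W, ⁅X, w⁆ ∈ W) →
      W = ⊥ ∨ W = adEigenspace 𝔤 z (-1))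
    (h4 : Submodule.span ℂ
        {v : 𝔤 | ∃ x ∈ adEigenspace 𝔤 z 1, ∃ y ∈ adEigenspace 𝔤 z (-1), v = ⁅x, y⁆}
      = adEigenspace 𝔤 z 0)
    (h5 : Submodule.span ℂ
        {v : 𝔤 | ∃ y ∈ adEigenspace 𝔤 z (-1), ∃ e ∈ adEigenspace 𝔤 z 2, v = ⁅y, e⁆}
      = adEigenspace 𝔤 z 1)
    (h5' : Submodule.span ℂ
        {v : 𝔤 | ∃ x ∈ adEigenspace 𝔤 z 1, ∃ f ∈ adEigenspace 𝔤 z (-2), v = ⁅x, f⁆}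
      = adEigenspace 𝔤 z (-1))
    (h6 : ∀ X ∈ adEigenspace 𝔤 z 0,
      (∀ x ∈ adEigenspace 𝔤 z 1, ⁅X, x⁆ = 0) →
      (∀ y ∈ adEigenspace 𝔤 z (-1), ⁅X, y⁆ = 0) → X = 0) :
    LieAlgebra.IsSimple ℂ 𝔤 := by
  have htop : ⨆ i, adEigenspace 𝔤 z ((![-2, -1, 0, 1, 2] : Fin 5 → ℤ) i) = ⊤ := by
    rw [← h1.submodule_iSup_eq_top]
    congr 1
    ext i
    fin_cases i <;> rfl
  have hz : z ∈ adEigenspace 𝔤 z 0 := by simp [mem_adEigenspace_iff]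
  have of_zero : ∀ I : LieIdeal ℂ 𝔤, adEigenspace 𝔤 z 0 ≤ I.toSubmodule → I = ⊤ := by
    intro I hI
    rw [← LieSubmodule.toSubmodule_eq_top, eq_top_iff, ← htop]
    refine iSup_le fun i => ?_
    generalize hk : (![-2, -1, 0, 1, 2] : Fin 5 → ℤ) i = k
    intro x hx
    rcases eq_or_ne k 0 with rfl | hk0
    · exact hI hx
    · have hzx : ⁅z, x⁆ ∈ I := lie_mem_left ℂ 𝔤 I z x (hI hz)
      rw [mem_adEigenspace_iff.mp hx] at hzx
      exact (Submodule.smul_mem_iff I.toSubmodule (Int.cast_ne_zero.mpr hk0)).mp hzx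
  have of_one : ∀ I : LieIdeal ℂ 𝔤, adEigenspace 𝔤 z 1 ≤ I.toSubmodule → I = ⊤ := by
    intro I hI
    refine of_zero I ?_
    rw [← h4, Submodule.span_le]
    rintro _ ⟨x, hx, y, -, rfl⟩
    exact lie_mem_left ℂ 𝔤 I x y (hI hx)
  have of_neg_one : ∀ I : LieIdeal ℂ 𝔤, adEigenspace 𝔤 z (-1) ≤ I.toSubmodule → I = ⊤ := by
    intro I hI
    refine of_zero I ?_
    rw [← h4, Submodule.span_le]
    rintro _ ⟨x, -, y, hy, rfl⟩
    exact lie_mem_right ℂ 𝔤 I x y (hI hy)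
  have one : ∀ I : LieIdeal ℂ 𝔤, ∀ x ∈ I, x ∈ adEigenspace 𝔤 z 1 → x ≠ 0 → I = ⊤ := by
    intro I x hxI hx hx0
    refine of_one I (inf_eq_right.mp ((h3 (I.toSubmodule ⊓ adEigenspace 𝔤 z 1) inf_le_right
      fun X hX w hw => ⟨lie_mem_right ℂ 𝔤 I X w hw.1,
        lie_mem_adEigenspace (zero_add 1) hX hw.2⟩).resolve_left ?_))
    exact (Submodule.ne_bot_iff _).mpr ⟨x, ⟨hxI, hx⟩, hx0⟩
  have neg_one : ∀ I : LieIdeal ℂ 𝔤, ∀ x ∈ I, x ∈ adEigenspace 𝔤 z (-1) → x ≠ 0 → I = ⊤ := by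
    intro I x hxI hx hx0
    refine of_neg_one I (inf_eq_right.mp ((h3' (I.toSubmodule ⊓ adEigenspace 𝔤 z (-1))
      inf_le_right fun X hX w hw => ⟨lie_mem_right ℂ 𝔤 I X w hw.1,
        lie_mem_adEigenspace (zero_add (-1)) hX hw.2⟩).resolve_left ?_))
    exact (Submodule.ne_bot_iff _).mpr ⟨x, ⟨hxI, hx⟩, hx0⟩
  have line : ∀ {k : ℤ} (I : LieIdeal ℂ 𝔤), Module.finrank ℂ (adEigenspace 𝔤 z k) = 1 →
      ∀ x ∈ I, x ∈ adEigenspace 𝔤 z k → x ≠ 0 → adEigenspace 𝔤 z k ≤ I.toSubmodule := by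
    intro k I hk x hxI hx hx0 y hy
    obtain ⟨c, hc⟩ := exists_smul_eq_of_finrank_eq_one hk
      (x := ⟨x, hx⟩) (fun h => hx0 (congrArg Subtype.val h)) ⟨y, hy⟩
    rw [← show c • x = y from congrArg Subtype.val hc]
    exact I.toSubmodule.smul_mem c hxI
  refine ⟨fun I => or_iff_not_imp_left.mpr fun hI => ?_, fun hab => ?_⟩
  · obtain ⟨μ, x, hxI, hx0, hμ⟩ := LieIdeal.exists_eigenvector_ad z hI
    obtain ⟨i, rfl⟩ := exists_eq_of_iSup_adEigenspace_eq_top htop hx0 hμ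
    rw [← mem_adEigenspace_iff] at hμ
    fin_cases i
    · refine of_neg_one I ?_
      rw [← h5', Submodule.span_le]
      rintro _ ⟨u, -, f, hf, rfl⟩
      exact lie_mem_right ℂ 𝔤 I u f (line I h2' x hxI hμ hx0 hf)
    · exact neg_one I x hxI hμ hx0
    · by_contra hI'
      refine hx0 (h6 x hμ (fun u hu => ?_) fun u hu => ?_)
      · by_contra h
        exact hI' (one I _ (lie_mem_left ℂ 𝔤 I x u hxI)
          (lie_mem_adEigenspace (zero_add 1) hμ hu) h)
      · by_contra h
        exact hI' (neg_one I _ (lie_mem_left ℂ 𝔤 I x u hxI)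
          (lie_mem_adEigenspace (zero_add (-1)) hμ hu) h)
    · exact one I x hxI hμ hx0
    · refine of_one I ?_
      rw [← h5, Submodule.span_le]
      rintro _ ⟨u, -, e, he, rfl⟩
      exact lie_mem_right ℂ 𝔤 I u e (line I h2 x hxI hμ hx0 he)
  · obtain ⟨x, hx, hx0⟩ := (Submodule.ne_bot_iff _).mp h2''
    rw [mem_adEigenspace_iff, trivial_lie_zero, Int.cast_one, one_smul] at hx
    exact hx0 hx.symm
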